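/- arXiv:1910.11217 — 2 statements merged into one kernel-verified Lean document; each statement's English description precedes it below -/
import Mathlib

section
/- Let G_1,…,G_{n2} : ℝ^{N2} → ℝ^{N1} be differentiable, each L_G-smooth with B_G-bounded Jacobian, G = (1/n2) Σ_j G_j, and let F_1,…,F_{n1} : ℝ^{N1} → ℝ be differentiable, each L_F-smooth with B_F-bounded gradient. Suppose moreover that for every i ∈ {1,…,n1}, j ∈ {1,…,n2} and all x, y: ‖[∇G_j(x)]ᵀ ∇F_i(G(x)) − [∇G_j(y)]ᵀ ∇F_i(G(y))‖ ≤ L‖x − y‖. Let ∇f(x) = (1/n1) Σ_i [∇G(x)]ᵀ ∇F_i(G(x)). Fix x, x̃ ∈ ℝ^{N2} and integers A, B, C ≥ 1. For σ : {1,…,A} → {1,…,n2}, τ : {1,…,B} → {1,…,n2}, ρ : {1,…,C} → {1,…,n1}, let Ĝ(σ) = (1/A) Σ_t (G_{σ(t)}(x) − G_{σ(t)}(x̃)) + G(x̃), ∇Ĝ(τ) = (1/B) Σ_t (∇G_{τ(t)}(x) − ∇G_{τ(t)}(x̃)) + ∇G(x̃), and ∇̃(σ,τ,ρ) = (1/C)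 Σ_{s=1}^{C} ([∇Ĝ(τ)]ᵀ ∇F_{ρ(s)}(Ĝ(σ)) − [∇G(x̃)]ᵀ ∇F_{ρ(s)}(G(x̃))) + ∇f(x̃). Then the average of ‖∇̃(σ,τ,ρ) − ∇f(x)‖² over all triples (σ,τ,ρ) (uniform over all maps) is at most (4 B_G⁴ L_F² / A + 4 B_F² L_G² / B + 2 L² / C) ‖x̃ − x‖². -/
open Matrix

/-- The Frobenius norm of a real matrix. -/
noncomputable def frobNorm {k l : Type*} [Fintype k] [Fintype l] (M : Matrix k l ℝ) : ℝ :=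
  Real.sqrt (∑ i, ∑ j, (M i j) ^ 2)

section Sampling

variable {ι V : Type*} [Fintype ι] [NormedAddCommGroup V] [InnerProductSpace ℝ V]

/-- Second moment of a sum of `k` independent uniform samples of a centered family. -/
lemma card_mul_sum_norm_sq_sum_sample (g : ι → V) (hg : ∑ j, g j = 0) (k : ℕ) :
    (Fintype.card ι : ℝ) * ∑ σ : Fin k → ι, ‖∑ t, g (σ t)‖ ^ 2
      = k * (Fintype.card ι : ℝ) ^ k * ∑ j, ‖g j‖ ^ 2 := by
  induction k with
  | zero => simp
  | succ k ih =>
    have hsum : ∑ σ : Fin (k + 1) → ι, ‖∑ t, g (σ t)‖ ^ 2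
        = ∑ j, ∑ σ : Fin k → ι, (‖g j‖ ^ 2 + 2 * inner ℝ (g j) (∑ t, g (σ t))
            + ‖∑ t, g (σ t)‖ ^ 2) := by
      rw [← (Fin.consEquiv fun _ => ι).sum_comp, Fintype.sum_prod_type]
      simp [Fin.sum_univ_succ, norm_add_sq_real]
    have hcross : ∑ j, ∑ σ : Fin k → ι, 2 * inner ℝ (g j) (∑ t, g (σ t)) = 0 := by
      rw [Finset.sum_comm]
      refine Finset.sum_eq_zero fun σ _ => ?_
      rw [← Finset.mul_sum, ← sum_inner, hg, inner_zero_left, mul_zero]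
    rw [hsum]
    simp only [Finset.sum_add_distrib, hcross]
    simp only [Finset.sum_const, Finset.card_univ, Fintype.card_fun, Fintype.card_fin,
      nsmul_eq_mul, ← Finset.mul_sum]
    rw [ih]
    push_cast
    ring

/-- The variance of the mean of `k` independent uniform samples, bounded through a uniform bound on
the sampled vectors. -/
lemma sum_norm_sq_sample_mean_sub_mean_le [Nonempty ι] (f : ι → V) {M : ℝ}
    (hf : ∀ j, ‖f j‖ ^ 2 ≤ M) {k : ℕ} (hk : 1 ≤ k) :
    ∑ σ : Fin k → ι, ‖(k : ℝ)⁻¹ • ∑ t, f (σ t) - (Fintype.card ι : ℝ)⁻¹ • ∑ j, f j‖ ^ 2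
      ≤ (Fintype.card ι : ℝ) ^ k * (M / k) := by
  have hn : (0 : ℝ) < Fintype.card ι := by exact_mod_cast Fintype.card_pos
  have hk0 : (0 : ℝ) < k := by exact_mod_cast hk
  set m : V := (Fintype.card ι : ℝ)⁻¹ • ∑ j, f j with hm
  have hnm : ∑ j, f j = (Fintype.card ι : ℝ) • m := by
    rw [hm, smul_inv_smul₀ hn.ne']
  have hcentered : ∑ j, (f j - m) = 0 := by
    rw [Finset.sum_sub_distrib, hnm]
    simp [Nat.cast_smul_eq_nsmul]
  have hmean (σ : Fin k → ι) :
      (k : ℝ)⁻¹ • ∑ t, f (σ t) - m = (k : ℝ)⁻¹ • ∑ t, (f (σ t) - m) := by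
    rw [Finset.sum_sub_distrib, smul_sub]
    simp [← Nat.cast_smul_eq_nsmul ℝ, smul_smul, hk0.ne']
  have hvar : ∑ j, ‖f j - m‖ ^ 2 ≤ Fintype.card ι * M := by
    have hexp : ∑ j, ‖f j - m‖ ^ 2 = ∑ j, ‖f j‖ ^ 2 - Fintype.card ι * ‖m‖ ^ 2 := by
      simp only [norm_sub_sq_real, Finset.sum_add_distrib, Finset.sum_sub_distrib,
        ← Finset.mul_sum, ← sum_inner]
      rw [hnm, real_inner_smul_left, real_inner_self_eq_norm_sq]
      simp
      ring
    have hle : ∑ j, ‖f j‖ ^ 2 ≤ Fintype.card ι * M := by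
      simpa using Finset.sum_le_sum fun j (_ : j ∈ Finset.univ) => hf j
    have : 0 ≤ Fintype.card ι * ‖m‖ ^ 2 := by positivity
    linarith
  have hsum := card_mul_sum_norm_sq_sum_sample (fun j => f j - m) hcentered k
  simp only [hmean, norm_smul, mul_pow, ← Finset.mul_sum]
  refine le_of_mul_le_mul_left ?_ hn
  rw [mul_left_comm, hsum]
  simp only [norm_inv, Real.norm_natCast]
  calc ((k : ℝ)⁻¹) ^ 2 * (k * (Fintype.card ι : ℝ) ^ k * ∑ j, ‖f j - m‖ ^ 2)
      ≤ ((k : ℝ)⁻¹) ^ 2 * (k * (Fintype.card ι : ℝ) ^ k * (Fintype.card ι * M)) := by gcongr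
    _ = Fintype.card ι * ((Fintype.card ι : ℝ) ^ k * (M / k)) := by field_simp

end Sampling

section Frobenius

variable {k l : Type*} [Fintype k] [Fintype l]

/-- A matrix seen as a Euclidean vector whose norm is the Frobenius norm. -/
noncomputable def frobVec : Matrix k l ℝ →ₗ[ℝ] EuclideanSpace ℝ (k × l) where
  toFun M := WithLp.toLp 2 fun p => M p.1 p.2
  map_add' _ _ := rfl
  map_smul' _ _ := rfl

lemma norm_frobVec (M : Matrix k l ℝ) : ‖frobVec M‖ = frobNorm M := by
  simp only [frobNorm, EuclideanSpace.norm_eq, Fintype.sum_prod_type, Real.norm_eq_abs, sq_abs]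
  rfl

lemma frobNorm_transpose (M : Matrix k l ℝ) : frobNorm Mᵀ = frobNorm M := by
  simp only [frobNorm, transpose_apply]
  rw [Finset.sum_comm]

lemma norm_toEuclideanLin_le [DecidableEq l] (M : Matrix k l ℝ) (v : EuclideanSpace ℝ l) :
    ‖toEuclideanLin M v‖ ≤ frobNorm M * ‖v‖ := by
  rw [EuclideanSpace.norm_eq, EuclideanSpace.norm_eq, frobNorm, ← Real.sqrt_mul (by positivity)]
  refine Real.sqrt_le_sqrt ?_
  simp only [Real.norm_eq_abs, sq_abs, Finset.sum_mul]
  refine Finset.sum_le_sum fun i _ => ?_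
  simpa [toLpLin_apply, mulVec, dotProduct, Finset.sum_mul] using
    Finset.sum_mul_sq_le_sq_mul_sq Finset.univ (M i) v

end Frobenius

lemma norm_inv_card_smul_sum_le {ι V : Type*} [Fintype ι] [Nonempty ι] [NormedAddCommGroup V]
    [NormedSpace ℝ V] (f : ι → V) {M : ℝ} (hf : ∀ j, ‖f j‖ ≤ M) :
    ‖(Fintype.card ι : ℝ)⁻¹ • ∑ j, f j‖ ≤ M := by
  have hn : (0 : ℝ) < Fintype.card ι := by exact_mod_cast Fintype.card_pos
  rw [norm_smul, norm_inv, Real.norm_natCast, inv_mul_le_iff₀ hn]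
  simpa using norm_sum_le_of_le Finset.univ fun j _ => hf j

lemma norm_add_sq_le_two {V : Type*} [SeminormedAddCommGroup V] (u v : V) :
    ‖u + v‖ ^ 2 ≤ 2 * ‖u‖ ^ 2 + 2 * ‖v‖ ^ 2 := by
  have := norm_add_le u v
  nlinarith [norm_nonneg (u + v), sq_nonneg (‖u‖ - ‖v‖)]

lemma norm_sub_le_of_frobNorm_le {k l : Type*} [Fintype k] [Fintype l] [DecidableEq l]
    {g : EuclideanSpace ℝ l → EuclideanSpace ℝ k}
    {D : EuclideanSpace ℝ l → Matrix k l ℝ} {b : ℝ}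
    (hg : ∀ x, HasFDerivAt g (toEuclideanLin (D x)).toContinuousLinearMap x)
    (hD : ∀ x, frobNorm (D x) ≤ b) (x y : EuclideanSpace ℝ l) :
    ‖g x - g y‖ ≤ b * ‖x - y‖ := by
  refine convex_univ.norm_image_sub_le_of_norm_hasFDerivWithin_le
    (fun z _ => (hg z).hasFDerivWithinAt) (fun z _ => ?_) (Set.mem_univ y) (Set.mem_univ x)
  refine ContinuousLinearMap.opNorm_le_bound _ ((Real.sqrt_nonneg _).trans (hD z)) fun v => ?_
  exact (norm_toEuclideanLin_le _ v).trans (by gcongr; exact hD z)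

/-- variance bound for the Option II variance-reduced gradient estimator
(Lemma 5.1 of the paper). -/
theorem optionII_gradient_estimator_variance_bound
    (N1 N2 n1 n2 : ℕ) (hn1 : 0 < n1) (hn2 : 0 < n2) (LG BG LF BF L : ℝ)
    (G : Fin n2 → EuclideanSpace ℝ (Fin N2) → EuclideanSpace ℝ (Fin N1))
    (DG : Fin n2 → EuclideanSpace ℝ (Fin N2) → Matrix (Fin N1) (Fin N2) ℝ)
    (hGd : ∀ j x, HasFDerivAt (G j) ((Matrix.toEuclideanLin (DG j x)).toContinuousLinearMap) x)
    (hGs : ∀ j x y, frobNorm (DG j x - DG j y) ≤ LG * ‖x - y‖)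
    (hGb : ∀ j x, frobNorm (DG j x) ≤ BG)
    (F : Fin n1 → EuclideanSpace ℝ (Fin N1) → ℝ)
    (hFd : ∀ i, Differentiable ℝ (F i))
    (hFs : ∀ i p q, ‖gradient (F i) p - gradient (F i) q‖ ≤ LF * ‖p - q‖)
    (hFb : ∀ i y, ‖gradient (F i) y‖ ≤ BF)
    (Gbar : EuclideanSpace ℝ (Fin N2) → EuclideanSpace ℝ (Fin N1))
    (hGbar : Gbar = fun x => (n2 : ℝ)⁻¹ • ∑ j, G j x)
    (DGbar : EuclideanSpace ℝ (Fin N2) → Matrix (Fin N1) (Fin N2) ℝ)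
    (hDGbar : DGbar = fun x => (n2 : ℝ)⁻¹ • ∑ j, DG j x)
    (hLip : ∀ (i : Fin n1) (j : Fin n2) (x y : EuclideanSpace ℝ (Fin N2)),
      ‖Matrix.toEuclideanLin (DG j x)ᵀ (gradient (F i) (Gbar x))
        - Matrix.toEuclideanLin (DG j y)ᵀ (gradient (F i) (Gbar y))‖ ≤ L * ‖x - y‖)
    (gradf : EuclideanSpace ℝ (Fin N2) → EuclideanSpace ℝ (Fin N2))
    (hgradf : gradf = fun x =>
      (n1 : ℝ)⁻¹ • ∑ i, Matrix.toEuclideanLin (DGbar x)ᵀ (gradient (F i) (Gbar x)))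
    (x xt : EuclideanSpace ℝ (Fin N2)) (A B C : ℕ) (hA : 1 ≤ A) (hB : 1 ≤ B) (hC : 1 ≤ C)
    (Ghat : (Fin A → Fin n2) → EuclideanSpace ℝ (Fin N1))
    (hGhat : ∀ σ, Ghat σ = ((A : ℝ)⁻¹ • ∑ t, (G (σ t) x - G (σ t) xt)) + Gbar xt)
    (DGhat : (Fin B → Fin n2) → Matrix (Fin N1) (Fin N2) ℝ)
    (hDGhat : ∀ τ, DGhat τ = ((B : ℝ)⁻¹ • ∑ t, (DG (τ t) x - DG (τ t) xt)) + DGbar xt)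
    (gradEst : (Fin A → Fin n2) → (Fin B → Fin n2) → (Fin C → Fin n1) →
      EuclideanSpace ℝ (Fin N2))
    (hgradEst : ∀ σ τ ρ, gradEst σ τ ρ = ((C : ℝ)⁻¹ • ∑ s,
      (Matrix.toEuclideanLin (DGhat τ)ᵀ (gradient (F (ρ s)) (Ghat σ))
        - Matrix.toEuclideanLin (DGbar xt)ᵀ (gradient (F (ρ s)) (Gbar xt)))) + gradf xt) :
    ((n2 : ℝ) ^ A)⁻¹ * ((n2 : ℝ) ^ B)⁻¹ * ((n1 : ℝ) ^ C)⁻¹ *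
        ∑ σ : Fin A → Fin n2, ∑ τ : Fin B → Fin n2, ∑ ρ : Fin C → Fin n1,
          ‖gradEst σ τ ρ - gradf x‖ ^ 2
      ≤ (4 * BG ^ 4 * LF ^ 2 / A + 4 * BF ^ 2 * LG ^ 2 / B + 2 * L ^ 2 / C) * ‖xt - x‖ ^ 2 := by
  have : Nonempty (Fin n1) := ⟨⟨0, hn1⟩⟩
  have : Nonempty (Fin n2) := ⟨⟨0, hn2⟩⟩
  have hn1' : (0 : ℝ) < n1 := by exact_mod_cast hn1
  have hn2' : (0 : ℝ) < n2 := by exact_mod_cast hn2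
  have hBF : 0 ≤ BF := (norm_nonneg _).trans (hFb ⟨0, hn1⟩ 0)
  have hBG : 0 ≤ BG := (Real.sqrt_nonneg _).trans (hGb ⟨0, hn2⟩ 0)
  have hvarG : ∑ σ, ‖Ghat σ - Gbar x‖ ^ 2 ≤ (n2 : ℝ) ^ A * ((BG * ‖x - xt‖) ^ 2 / A) := by
    have h := sum_norm_sq_sample_mean_sub_mean_le (fun j => G j x - G j xt)
      (M := (BG * ‖x - xt‖) ^ 2)
      (fun j => pow_le_pow_left₀ (norm_nonneg _)
        (norm_sub_le_of_frobNorm_le (hGd j) (hGb j) x xt) 2) hA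
    rw [Fintype.card_fin] at h
    refine le_of_eq_of_le (Finset.sum_congr rfl fun σ _ => ?_) h
    congr 2
    rw [hGhat, hGbar]
    simp only [Finset.sum_sub_distrib, smul_sub]
    abel
  have hvarDG : ∑ τ, frobNorm (DGhat τ - DGbar x) ^ 2
      ≤ (n2 : ℝ) ^ B * ((LG * ‖x - xt‖) ^ 2 / B) := by
    have h := sum_norm_sq_sample_mean_sub_mean_le (fun j => frobVec (DG j x - DG j xt))
      (M := (LG * ‖x - xt‖) ^ 2)
      (fun j => pow_le_pow_left₀ (norm_nonneg _)
        ((norm_frobVec _).trans_le (hGs j x xt)) 2) hB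
    rw [Fintype.card_fin] at h
    refine le_of_eq_of_le (Finset.sum_congr rfl fun τ _ => ?_) h
    rw [← norm_frobVec]
    congr 2
    rw [hDGhat, hDGbar]
    simp only [← map_sum, ← map_smul, ← map_sub]
    congr 1
    simp only [Finset.sum_sub_distrib, smul_sub]
    abel
  let h (i : Fin n1) (y : EuclideanSpace ℝ (Fin N2)) : EuclideanSpace ℝ (Fin N2) :=
    toEuclideanLin (DGbar y)ᵀ (gradient (F i) (Gbar y))
  have hh (i : Fin n1) (y : EuclideanSpace ℝ (Fin N2)) : h i y
      = (n2 : ℝ)⁻¹ • ∑ j, toEuclideanLin (DG j y)ᵀ (gradient (F i) (Gbar y)) := by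
    simp only [h, hDGbar, transpose_smul, transpose_sum, map_smul, map_sum,
      LinearMap.smul_apply, LinearMap.sum_apply]
  have hhLip (i : Fin n1) : ‖h i x - h i xt‖ ≤ L * ‖x - xt‖ := by
    rw [hh, hh, ← smul_sub, ← Finset.sum_sub_distrib]
    simpa using norm_inv_card_smul_sum_le _ fun j => hLip i j x xt
  let T (ρ : Fin C → Fin n1) : EuclideanSpace ℝ (Fin N2) :=
    (C : ℝ)⁻¹ • ∑ s, (h (ρ s) x - h (ρ s) xt) - (n1 : ℝ)⁻¹ • ∑ i, (h i x - h i xt)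
  have hvarT : ∑ ρ, ‖T ρ‖ ^ 2 ≤ (n1 : ℝ) ^ C * ((L * ‖x - xt‖) ^ 2 / C) := by
    have h' := sum_norm_sq_sample_mean_sub_mean_le (fun i => h i x - h i xt)
      (M := (L * ‖x - xt‖) ^ 2)
      (fun i => pow_le_pow_left₀ (norm_nonneg _) (hhLip i) 2) hC
    rwa [Fintype.card_fin] at h'
  have hDGbarb : frobNorm (DGbar x) ≤ BG := by
    rw [← norm_frobVec, hDGbar, map_smul, map_sum]
    simpa using norm_inv_card_smul_sum_le (fun j => frobVec (DG j x))
      fun j => (norm_frobVec _).trans_le (hGb j x)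
  have hterm (σ : Fin A → Fin n2) (τ : Fin B → Fin n2) (i : Fin n1) :
      ‖toEuclideanLin (DGhat τ)ᵀ (gradient (F i) (Ghat σ)) - h i x‖
        ≤ frobNorm (DGhat τ - DGbar x) * BF + BG * (LF * ‖Ghat σ - Gbar x‖) := by
    have hsplit : toEuclideanLin (DGhat τ)ᵀ (gradient (F i) (Ghat σ)) - h i x
        = toEuclideanLin (DGhat τ - DGbar x)ᵀ (gradient (F i) (Ghat σ))
          + toEuclideanLin (DGbar x)ᵀ (gradient (F i) (Ghat σ) - gradient (F i) (Gbar x)) := by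
      simp only [h, transpose_sub, map_sub, LinearMap.sub_apply]
      abel
    rw [hsplit]
    refine norm_add_le_of_le ((norm_toEuclideanLin_le _ _).trans ?_)
      ((norm_toEuclideanLin_le _ _).trans ?_)
    · rw [frobNorm_transpose]
      exact mul_le_mul_of_nonneg_left (hFb i _) (Real.sqrt_nonneg _)
    · rw [frobNorm_transpose]
      exact mul_le_mul hDGbarb (hFs i _ _) (norm_nonneg _) hBG
  have hpoint (σ : Fin A → Fin n2) (τ : Fin B → Fin n2) (ρ : Fin C → Fin n1) :
      ‖gradEst σ τ ρ - gradf x‖ ^ 2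
        ≤ 4 * BG ^ 2 * LF ^ 2 * ‖Ghat σ - Gbar x‖ ^ 2
          + 4 * BF ^ 2 * frobNorm (DGhat τ - DGbar x) ^ 2 + 2 * ‖T ρ‖ ^ 2 := by
    have : Nonempty (Fin C) := ⟨⟨0, hC⟩⟩
    have hdecomp : gradEst σ τ ρ - gradf x = (C : ℝ)⁻¹ • ∑ s,
        (toEuclideanLin (DGhat τ)ᵀ (gradient (F (ρ s)) (Ghat σ)) - h (ρ s) x) + T ρ := by
      rw [hgradEst, hgradf]
      simp only [T, h, Finset.sum_sub_distrib, smul_sub]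
      abel
    have hmean := norm_inv_card_smul_sum_le _ fun s => hterm σ τ (ρ s)
    rw [Fintype.card_fin] at hmean
    rw [hdecomp]
    refine (norm_add_sq_le_two _ _).trans ?_
    have hsq := pow_le_pow_left₀ (norm_nonneg _) hmean 2
    nlinarith [sq_nonneg (frobNorm (DGhat τ - DGbar x) * BF - BG * (LF * ‖Ghat σ - Gbar x‖))]
  have hsum : ∑ σ : Fin A → Fin n2, ∑ τ : Fin B → Fin n2, ∑ ρ : Fin C → Fin n1,
      ‖gradEst σ τ ρ - gradf x‖ ^ 2
        ≤ (n2 : ℝ) ^ A * (n2 : ℝ) ^ B * (n1 : ℝ) ^ C *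
          ((4 * BG ^ 4 * LF ^ 2 / A + 4 * BF ^ 2 * LG ^ 2 / B + 2 * L ^ 2 / C)
            * ‖xt - x‖ ^ 2) := by
    calc _ ≤ ∑ σ : Fin A → Fin n2, ∑ τ : Fin B → Fin n2, ∑ ρ : Fin C → Fin n1,
          (4 * BG ^ 2 * LF ^ 2 * ‖Ghat σ - Gbar x‖ ^ 2
            + 4 * BF ^ 2 * frobNorm (DGhat τ - DGbar x) ^ 2 + 2 * ‖T ρ‖ ^ 2) := by
          gcongr with σ _ τ _ ρ _
          exact hpoint σ τ ρ
      _ = (n2 : ℝ) ^ B * (n1 : ℝ) ^ C * (4 * BG ^ 2 * LF ^ 2 * ∑ σ, ‖Ghat σ - Gbar x‖ ^ 2)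
          + (n2 : ℝ) ^ A * (n1 : ℝ) ^ C *
            (4 * BF ^ 2 * ∑ τ, frobNorm (DGhat τ - DGbar x) ^ 2)
          + (n2 : ℝ) ^ A * (n2 : ℝ) ^ B * (2 * ∑ ρ, ‖T ρ‖ ^ 2) := by
          simp only [Finset.sum_add_distrib, Finset.sum_const, Finset.card_univ,
            Fintype.card_fun, Fintype.card_fin, nsmul_eq_mul, ← Finset.mul_sum]
          push_cast
          ring
      _ ≤ (n2 : ℝ) ^ B * (n1 : ℝ) ^ C *
            (4 * BG ^ 2 * LF ^ 2 * ((n2 : ℝ) ^ A * ((BG * ‖x - xt‖) ^ 2 / A)))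
          + (n2 : ℝ) ^ A * (n1 : ℝ) ^ C *
            (4 * BF ^ 2 * ((n2 : ℝ) ^ B * ((LG * ‖x - xt‖) ^ 2 / B)))
          + (n2 : ℝ) ^ A * (n2 : ℝ) ^ B *
            (2 * ((n1 : ℝ) ^ C * ((L * ‖x - xt‖) ^ 2 / C))) := by gcongr
      _ = _ := by
          rw [norm_sub_rev xt x]
          ring
  rwa [← mul_inv, ← mul_inv, inv_mul_le_iff₀ (by positivity)]
end

section
/- Let L > 0, μ > 0, let f : ℝ^N → ℝ be convex, differentiable and L-smooth, and let h : ℝ^N → ℝ be μ-strongly convex; set H = f + h and let x* be the minimizer of H. Let α > 0, τ₁ ∈ (0, 1/(3αL)], τ₂ ∈ [0, 1 − τ₁]. Fix z_k, y_k, x̃ ∈ ℝ^N and set x_{k+1} = τ₁ z_k + τ₂ x̃ + (1 − τ₁ − τ₂) y_k. Let g̃ ∈ ℝ^N, and suppose z_{k+1} minimizes z ↦ ⟨g̃, z⟩ + (1/(2α))‖z − z_k‖² + h(z) over ℝ^N and y_{k+1} minimizes y ↦ ⟨g̃, y⟩ + (3L/2)‖y − x_{k+1}‖² + h(y) over ℝ^N.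 Then for every β > 0: 0 ≤ (τ₂/τ₁)(H(x̃) − H(x*)) + ((1 − τ₁ − τ₂)/τ₁)(H(y_k) − H(x*)) − (1/τ₁)(H(y_{k+1}) − H(x*)) + (1/(4τ₁L) + β/2)‖g̃ − ∇f(x_{k+1})‖² + ((1 + α/β)/(2α))‖z_k − x*‖² − ((1 + αμ)/(2α))‖z_{k+1} − x*‖². -/
open scoped RealInnerProductSpace

section

variable {E : Type*} [NormedAddCommGroup E] [InnerProductSpace ℝ E]

/-- A strongly convex function grows quadratically away from a minimizer. -/
theorem StrongConvexOn.add_sq_norm_sub_le_of_forall_le {φ : E → ℝ} {m : ℝ}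
    (hφ : StrongConvexOn Set.univ m φ) {z : E} (hz : ∀ u, φ z ≤ φ u) (u : E) :
    φ z + m / 2 * ‖u - z‖ ^ 2 ≤ φ u := by
  have key : ∀ t ∈ Set.Ioo (0 : ℝ) 1, (1 - t) * (m / 2 * ‖u - z‖ ^ 2) ≤ φ u - φ z := by
    rintro t ⟨ht0, ht1⟩
    have h := hφ.2 (Set.mem_univ u) (Set.mem_univ z) ht0.le (sub_nonneg.2 ht1.le) (by ring)
    have h' := hz (t • u + (1 - t) • z)
    simp only [smul_eq_mul] at h
    refine le_of_mul_le_mul_left ?_ ht0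
    linarith
  have hlim : Filter.Tendsto (fun t : ℝ => (1 - t) * (m / 2 * ‖u - z‖ ^ 2))
      (nhdsWithin 0 (Set.Ioi 0)) (nhds (m / 2 * ‖u - z‖ ^ 2)) := by
    have hc : Continuous fun t : ℝ => (1 - t) * (m / 2 * ‖u - z‖ ^ 2) := by fun_prop
    simpa using (hc.tendsto 0).mono_left nhdsWithin_le_nhds
  have := le_of_tendsto hlim
    (Filter.eventually_of_mem (Ioo_mem_nhdsGT one_pos) key)
  linarith

/-- The three-point inequality for a proximal step on a strongly convex function. -/
theorem StrongConvexOn.prox_three_point {h : E → ℝ} {μ : ℝ} (hh : StrongConvexOn Set.univ μ h)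
    {c : ℝ} {g w z : E}
    (hz : ∀ u, ⟪g, z⟫ + c / 2 * ‖z - w‖ ^ 2 + h z ≤ ⟪g, u⟫ + c / 2 * ‖u - w‖ ^ 2 + h u) (u : E) :
    ⟪g, z⟫ + c / 2 * ‖z - w‖ ^ 2 + h z + (c + μ) / 2 * ‖u - z‖ ^ 2
      ≤ ⟪g, u⟫ + c / 2 * ‖u - w‖ ^ 2 + h u := by
  refine StrongConvexOn.add_sq_norm_sub_le_of_forall_le
    (φ := fun u => ⟪g, u⟫ + c / 2 * ‖u - w‖ ^ 2 + h u) ?_ hz u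
  rw [strongConvexOn_iff_convex] at hh ⊢
  have hlin : ConvexOn ℝ Set.univ fun u : E => ⟪g - c • w, u⟫ :=
    (innerSL ℝ (g - c • w)).toLinearMap.convexOn convex_univ
  refine ((hh.add hlin).add_const (c / 2 * ‖w‖ ^ 2)).congr fun v _ => ?_
  simp only [Pi.add_apply, norm_sub_sq_real, inner_sub_left, real_inner_smul_left,
    real_inner_comm v w]
  ring

variable [CompleteSpace E] {f : E → ℝ}

theorem Differentiable.hasDerivAt_comp_add_smul (hf : Differentiable ℝ f) (x d : E) (t : ℝ) :
    HasDerivAt (fun s : ℝ => f (x + s • d)) ⟪gradient f (x + t • d), d⟫ t := by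
  have hl : HasDerivAt (fun s : ℝ => x + s • d) d t := by
    simpa using ((hasDerivAt_id t).smul_const d).const_add x
  exact (hf (x + t • d)).hasGradientAt.hasFDerivAt.comp_hasDerivAt t hl

/-- The first-order characterization of convexity. -/
theorem ConvexOn.add_inner_gradient_le (hc : ConvexOn ℝ Set.univ f) (hf : Differentiable ℝ f)
    (x y : E) : f x + ⟪gradient f x, y - x⟫ ≤ f y := by
  have hline : ConvexOn ℝ Set.univ fun s : ℝ => f (x + s • (y - x)) := by
    have := hc.comp_affineMap (AffineMap.lineMap x y : ℝ →ᵃ[ℝ] E)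
    refine this.congr fun s _ => ?_
    simp [AffineMap.lineMap_apply, add_comm]
  have hd := hf.hasDerivAt_comp_add_smul x (y - x) 0
  have := hline.le_slope_of_hasDerivAt (Set.mem_univ 0) (Set.mem_univ 1) one_pos hd
  simp only [slope_def_field, zero_smul, add_zero, one_smul, add_sub_cancel, sub_zero,
    div_one] at this
  linarith

/-- The descent lemma for functions with Lipschitz gradient. -/
theorem Differentiable.le_add_inner_gradient_add_sq (hf : Differentiable ℝ f) {L : ℝ}
    (hL : ∀ x y, ‖gradient f x - gradient f y‖ ≤ L * ‖x - y‖) (x y : E) :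
    f y ≤ f x + ⟪gradient f x, y - x⟫ + L / 2 * ‖y - x‖ ^ 2 := by
  set d := y - x with hd
  have hder (t : ℝ) : HasDerivAt
      (fun s : ℝ => f (x + s • d) - (s * ⟪gradient f x, d⟫ + L / 2 * ‖d‖ ^ 2 * s ^ 2))
      (⟪gradient f (x + t • d), d⟫ - (⟪gradient f x, d⟫ + L * ‖d‖ ^ 2 * t)) t := by
    convert! (hf.hasDerivAt_comp_add_smul x d t).sub
      (((hasDerivAt_id t).mul_const ⟪gradient f x, d⟫).add
        ((hasDerivAt_pow 2 t).const_mul (L / 2 * ‖d‖ ^ 2))) using 1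
    simp
    ring
  have hanti := antitoneOn_of_hasDerivWithinAt_nonpos (convex_Icc (0 : ℝ) 1)
    (fun t _ => (hder t).continuousAt.continuousWithinAt)
    (fun t _ => (hder t).hasDerivWithinAt) (fun t ht => by
      rw [interior_Icc] at ht
      have h1 := real_inner_le_norm (gradient f (x + t • d) - gradient f x) d
      have h2 := mul_le_mul_of_nonneg_right (hL (x + t • d) x) (norm_nonneg d)
      rw [add_sub_cancel_left, norm_smul, Real.norm_of_nonneg ht.1.le] at h2
      rw [inner_sub_left] at h1
      linarith)
  have h := hanti (Set.left_mem_Icc.2 zero_le_one) (Set.right_mem_Icc.2 zero_le_one) zero_le_one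
  have hy : x + d = y := by rw [hd, add_sub_cancel]
  simp only [zero_smul, add_zero, one_smul, hy] at h
  linarith

end

/-- one-inner-iteration inequality (Lemma `cp-step2`). -/
theorem one_inner_iteration_bound
    (N : ℕ) (L μ α τ₁ τ₂ : ℝ) (hL : 0 < L) (hμ : 0 < μ) (hα : 0 < α)
    (hτ₁ : 0 < τ₁) (hτ₁' : τ₁ ≤ 1 / (3 * α * L)) (hτ₂ : 0 ≤ τ₂) (hτ₂' : τ₂ ≤ 1 - τ₁)
    (f h : EuclideanSpace ℝ (Fin N) → ℝ)
    (hfconv : ConvexOn ℝ Set.univ f)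
    (hf : Differentiable ℝ f)
    (hsmooth : ∀ x y : EuclideanSpace ℝ (Fin N),
      ‖gradient f x - gradient f y‖ ≤ L * ‖x - y‖)
    (hconv : ConvexOn ℝ Set.univ (fun x => h x - μ / 2 * ‖x‖ ^ 2))
    (H : EuclideanSpace ℝ (Fin N) → ℝ) (hH : H = fun z => f z + h z)
    (xs : EuclideanSpace ℝ (Fin N)) (hmin : ∀ u, H xs ≤ H u)
    (zk yk xt x1 : EuclideanSpace ℝ (Fin N))
    (hx1 : x1 = τ₁ • zk + τ₂ • xt + (1 - τ₁ - τ₂) • yk)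
    (gt z1 y1 : EuclideanSpace ℝ (Fin N))
    (hz1 : ∀ z : EuclideanSpace ℝ (Fin N),
      ⟪gt, z1⟫ + 1 / (2 * α) * ‖z1 - zk‖ ^ 2 + h z1
        ≤ ⟪gt, z⟫ + 1 / (2 * α) * ‖z - zk‖ ^ 2 + h z)
    (hy1 : ∀ y : EuclideanSpace ℝ (Fin N),
      ⟪gt, y1⟫ + 3 * L / 2 * ‖y1 - x1‖ ^ 2 + h y1
        ≤ ⟪gt, y⟫ + 3 * L / 2 * ‖y - x1‖ ^ 2 + h y) :
    ∀ β : ℝ, 0 < β →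
      0 ≤ τ₂ / τ₁ * (H xt - H xs) + (1 - τ₁ - τ₂) / τ₁ * (H yk - H xs)
          - 1 / τ₁ * (H y1 - H xs)
          + (1 / (4 * τ₁ * L) + β / 2) * ‖gt - gradient f x1‖ ^ 2
          + (1 + α / β) / (2 * α) * ‖zk - xs‖ ^ 2
          - (1 + α * μ) / (2 * α) * ‖z1 - xs‖ ^ 2 := by
  intro β hβ
  subst hH
  dsimp only
  set G := gradient f x1 with hG
  have hh : StrongConvexOn Set.univ μ h := strongConvexOn_iff_convex.2 hconv
  have hτ₃ : 0 ≤ 1 - τ₁ - τ₂ := by linarith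
  have hfs := hfconv.add_inner_gradient_le hf x1 xs
  have hft := mul_le_mul_of_nonneg_left (hfconv.add_inner_gradient_le hf x1 xt) hτ₂
  have hfk := mul_le_mul_of_nonneg_left (hfconv.add_inner_gradient_le hf x1 yk) hτ₃
  have hfy := hf.le_add_inner_gradient_add_sq hsmooth x1 y1
  rw [← hG] at hfs hft hfk hfy
  have hz := hh.prox_three_point (c := 1 / α) (g := gt) (w := zk) (z := z1)
    (fun u => by simpa only [div_div, mul_comm α 2] using hz1 u) xs
  -- the point at which the optimality of `y1` is tested
  set v := τ₁ • z1 + τ₂ • xt + (1 - τ₁ - τ₂) • yk with hv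
  have hhv : h v ≤ τ₁ * h z1 + τ₂ * h xt + (1 - τ₁ - τ₂) * h yk := by
    have hhc : ConvexOn ℝ Set.univ h := hh.convexOn fun r => by
      simp only [Pi.zero_apply]; positivity
    have := hhc.map_sum_le (t := Finset.univ) (w := ![τ₁, τ₂, 1 - τ₁ - τ₂]) (p := ![z1, xt, yk])
      (by intro i _; fin_cases i <;> simp <;> linarith)
      (by simp [Fin.sum_univ_three]) (by simp)
    simpa [Fin.sum_univ_three, hv] using this
  have hvx : v - x1 = τ₁ • (z1 - zk) := by rw [hv, hx1]; module
  have hyv := hy1 v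
  have hnv : ‖v - x1‖ ^ 2 = τ₁ ^ 2 * ‖z1 - zk‖ ^ 2 := by
    rw [hvx, norm_smul, mul_pow, Real.norm_of_nonneg hτ₁.le]
  have hgv : ⟪gt, v⟫ = ⟪gt, x1⟫ + τ₁ * (⟪gt, z1⟫ - ⟪gt, zk⟫) := by
    rw [← inner_sub_right, ← real_inner_smul_right, ← hvx, inner_sub_right]; ring
  have hcoef : 3 * L / 2 * ‖v - x1‖ ^ 2 ≤ τ₁ * (1 / α / 2 * ‖z1 - zk‖ ^ 2) := by
    have h3 : 3 * L * τ₁ ≤ 1 / α := by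
      rw [le_div_iff₀ (by positivity)] at hτ₁' ⊢
      linarith
    have := mul_le_mul_of_nonneg_right h3 (by positivity : 0 ≤ τ₁ / 2 * ‖z1 - zk‖ ^ 2)
    rw [hnv]
    linarith
  have hGx : ⟪G, x1⟫ = τ₁ * ⟪G, zk⟫ + τ₂ * ⟪G, xt⟫ + (1 - τ₁ - τ₂) * ⟪G, yk⟫ := by
    rw [hx1]; simp only [inner_add_right, real_inner_smul_right]
  have young {c : ℝ} (hc : 0 < c) (a b : EuclideanSpace ℝ (Fin N)) :
      ⟪a, b⟫ ≤ c / 2 * ‖a‖ ^ 2 + 1 / c / 2 * ‖b‖ ^ 2 := by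
    have h0 : 0 ≤ 1 / c / 2 * (c * ‖a‖ - ‖b‖) ^ 2 := by positivity
    have h1 : 1 / c / 2 * (c * ‖a‖ - ‖b‖) ^ 2
        = c / 2 * ‖a‖ ^ 2 + 1 / c / 2 * ‖b‖ ^ 2 - ‖a‖ * ‖b‖ := by field_simp; ring
    linarith [real_inner_le_norm a b]
  have hY1 := young hβ (gt - G) (xs - zk)
  have hY2 := young (c := 1 / (2 * L)) (by positivity) (gt - G) (x1 - y1)
  have e2 : 1 / (1 / (2 * L)) / 2 = L := by field_simp
  rw [e2] at hY2
  rw [norm_sub_rev xs zk] at hY1 hz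
  rw [norm_sub_rev x1 y1] at hY2
  rw [norm_sub_rev xs z1] at hz
  simp only [inner_sub_left, inner_sub_right] at hY1 hY2 hfs hft hfk hfy
  have hmain : 0 ≤ τ₂ * (f xt + h xt - (f xs + h xs))
      + (1 - τ₁ - τ₂) * (f yk + h yk - (f xs + h xs)) - (f y1 + h y1 - (f xs + h xs))
      + (1 / (2 * L) / 2 + τ₁ * (β / 2)) * ‖gt - G‖ ^ 2
      + τ₁ * (1 / α / 2 + 1 / β / 2) * ‖zk - xs‖ ^ 2
      - τ₁ * ((1 / α + μ) / 2) * ‖z1 - xs‖ ^ 2 := by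
    have hz' := mul_le_mul_of_nonneg_left hz hτ₁.le
    have hY1' := mul_le_mul_of_nonneg_left hY1 hτ₁.le
    have hfs' := mul_le_mul_of_nonneg_left hfs hτ₁.le
    linarith
  refine (div_nonneg hmain hτ₁.le).trans_eq ?_
  field_simp
  ring
end
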